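/- Let M be a manifold of class C¹ without boundary (modeled on a finite-dimensional real vector space), let X₀ ⊆ M be a compact subset, let φ : M → M be a C¹ map, and let (t,x) ↦ ψ^t(x) be a C¹ map [0,1]×M → M with ψ⁰ = id. Assume there exists a C¹ function f : M → ℝ such that f(X₀) ⊆ (−∞,0], f(φ(X₀)) ⊆ [0,∞), and for every x ∈ X₀: d/dt|_{t=0} f(ψ^t(x)) ≤ 0 and d/dt|_{t=0} f(φ(ψ^t(x))) > 0. Then there exists t₀ > 0 such that for every t ∈ (0,t₀], one has φ(ψ^t(X₀)) ∩ ψ^t(X₀) = ∅. -/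

import Mathlib

open Set Filter
open scoped Topology Manifold

/-- If the right derivative of a function of class `C¹` in the first variable is less than `c` at
`(0, y₀)`, then the function grows in the first variable with slope at most `c` near `(0, y₀)`. -/
theorem ContDiffWithinAt.eventually_le_add_mul {E : Type*} [NormedAddCommGroup E]
    [NormedSpace ℝ E] {G : ℝ × E → ℝ} {y₀ : E} {c : ℝ}
    (hG : ContDiffWithinAt ℝ 1 G (Icc (0:ℝ) 1 ×ˢ univ) (0, y₀))
    (hc : derivWithin (fun t => G (t, y₀)) (Ici (0:ℝ)) 0 < c) :
    ∀ᶠ p : ℝ × E in 𝓝 (0, y₀), 0 ≤ p.1 → G p ≤ G (0, p.2) + c * p.1 := by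
  have hmem : ((0:ℝ), y₀) ∈ Icc (0:ℝ) 1 ×ˢ (univ : Set E) := by simp
  obtain ⟨u, hu, -, G', hG', hG'c⟩ :=
    (contDiffWithinAt_succ_iff_hasFDerivWithinAt (n := 0) (by simp)).1 (by simpa using hG)
  rw [insert_eq_of_mem hmem] at hu
  have hmemu : ((0:ℝ), y₀) ∈ u := mem_of_mem_nhdsWithin hmem hu
  have hcont : Tendsto G' (𝓝[u] (0, y₀)) (𝓝 (G' (0, y₀))) := hG'c.continuousWithinAt
  have hIci : Ici (0:ℝ) ×ˢ (univ : Set E) ∩ Iio 1 ×ˢ univ ⊆ Icc (0:ℝ) 1 ×ˢ univ := by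
    rintro ⟨t, y⟩ ⟨⟨h0, -⟩, h1, -⟩
    exact ⟨⟨h0, le_of_lt h1⟩, trivial⟩
  have hu' : u ∈ 𝓝[Ici (0:ℝ) ×ˢ univ] ((0:ℝ), y₀) := by
    have h1 : Iio (1:ℝ) ×ˢ (univ : Set E) ∈ 𝓝 ((0:ℝ), y₀) :=
      prod_mem_nhds (Iio_mem_nhds one_pos) univ_mem
    rw [← nhdsWithin_inter_of_mem' (mem_nhdsWithin_of_mem_nhds h1)]
    exact nhdsWithin_mono _ hIci hu
  have hderiv : derivWithin (fun t => G (t, y₀)) (Ici (0:ℝ)) 0 = G' (0, y₀) (1, 0) := by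
    have hline : HasDerivWithinAt (fun t : ℝ => (t, y₀)) (1, 0) (Ici 0) 0 :=
      (hasDerivWithinAt_id _ _).prodMk (hasDerivWithinAt_const _ _ _)
    have hG0 : HasFDerivWithinAt G (G' (0, y₀)) (Ici (0:ℝ) ×ˢ univ) (0, y₀) :=
      (hG' _ hmemu).mono_of_mem_nhdsWithin hu'
    have hmaps : MapsTo (fun t : ℝ => (t, y₀)) (Ici 0) (Ici (0:ℝ) ×ˢ univ) :=
      fun t ht => ⟨ht, trivial⟩
    exact (hG0.comp_hasDerivWithinAt (0:ℝ) hline hmaps).derivWithin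
      (uniqueDiffOn_Ici _ _ self_mem_Ici)
  set ε := c - G' (0, y₀) (1, 0) with hε
  have hε0 : 0 < ε := by rw [hε, ← hderiv]; linarith
  have hnear : ∀ᶠ p in 𝓝[Ici (0:ℝ) ×ˢ univ] ((0:ℝ), y₀), p ∈ u ∧ ‖G' p - G' (0, y₀)‖ < ε := by
    refine Filter.Eventually.and hu' ?_
    have : ∀ᶠ p in 𝓝[u] ((0:ℝ), y₀), ‖G' p - G' (0, y₀)‖ < ε := by
      filter_upwards [hcont (Metric.ball_mem_nhds _ hε0)] with p hp
      simpa [dist_eq_norm] using hp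
    exact nhdsWithin_le_of_mem hu' this
  obtain ⟨δ, hδ, hball⟩ := Metric.mem_nhdsWithin_iff.1 hnear
  filter_upwards [Metric.ball_mem_nhds ((0:ℝ), y₀) hδ] with p hp hp0
  set s : Set (ℝ × E) := Metric.ball ((0:ℝ), y₀) δ ∩ Ici (0:ℝ) ×ˢ univ
  have hconv : Convex ℝ s := (convex_ball _ _).inter ((convex_Ici 0).prod convex_univ)
  have hsu : s ⊆ u := fun q hq => (hball hq).1
  have hps : p ∈ s := ⟨hp, hp0, trivial⟩
  have hqs : ((0:ℝ), p.2) ∈ s := by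
    refine ⟨?_, self_mem_Ici, trivial⟩
    rw [Metric.mem_ball, Prod.dist_eq, max_lt_iff] at hp ⊢
    exact ⟨by simpa using hδ, hp.2⟩
  have hmv := hconv.norm_image_sub_le_of_norm_hasFDerivWithin_le'
    (fun q hq => (hG' q (hsu hq)).mono hsu) (fun q hq => (hball hq).2.le) hqs hps
  have hsub : p - (0, p.2) = p.1 • ((1:ℝ), (0:E)) := by ext <;> simp
  have hnorm : ‖p.1 • ((1:ℝ), (0:E))‖ = p.1 := by
    simpa [Prod.norm_def] using hp0
  rw [hsub, hnorm, map_smul, smul_eq_mul] at hmv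
  have := (le_abs_self _).trans hmv
  rw [hε] at this
  linarith

/-- Manifold version of `ContDiffWithinAt.eventually_le_add_mul`. -/
theorem ContMDiffWithinAt.eventually_le_add_mul {E : Type*} [NormedAddCommGroup E]
    [NormedSpace ℝ E] {M : Type*} [TopologicalSpace M] [ChartedSpace E M]
    {g : ℝ × M → ℝ} {x₀ : M} {c : ℝ}
    (hg : ContMDiffWithinAt (𝓘(ℝ, ℝ).prod 𝓘(ℝ, E)) 𝓘(ℝ) 1 g (Icc (0:ℝ) 1 ×ˢ univ) (0, x₀))
    (hc : derivWithin (fun t => g (t, x₀)) (Ici (0:ℝ)) 0 < c) :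
    ∀ᶠ p : ℝ × M in 𝓝 (0, x₀), 0 ≤ p.1 → g p ≤ g (0, p.2) + c * p.1 := by
  set e := extChartAt 𝓘(ℝ, E) x₀ with he
  have hG : ContDiffWithinAt ℝ 1 (fun q : ℝ × E => g (q.1, e.symm q.2))
      (Icc (0:ℝ) 1 ×ˢ univ) (0, e x₀) := by
    have h := (contMDiffWithinAt_iff.1 hg).2
    exact h.mono fun q hq => ⟨⟨hq.1, trivial⟩, by simp⟩
  have hev := hG.eventually_le_add_mul (c := c) (by simpa [he] using hc)
  have hmap : Tendsto (fun p : ℝ × M => (p.1, e p.2)) (𝓝 (0, x₀)) (𝓝 (0, e x₀)) :=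
    (continuousAt_fst.prodMk
      ((continuousAt_extChartAt (I := 𝓘(ℝ, E)) x₀).comp continuousAt_snd :
        ContinuousAt (fun p : ℝ × M => e p.2) (0, x₀)))
  have hsrc : ∀ᶠ p : ℝ × M in 𝓝 (0, x₀), p.2 ∈ e.source :=
    continuousAt_snd.eventually (extChartAt_source_mem_nhds (I := 𝓘(ℝ, E)) x₀)
  filter_upwards [hmap.eventually hev, hsrc] with p hp hps hp0
  simpa [e.left_inv hps] using hp hp0

/-- separation of a compact set from its image under `φ` after a short
push by `ψ^t`, on a `C¹` manifold `M` without boundary modeled on a finite-dimensional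
real vector space `EM`. -/
theorem stmt16 {EM : Type*} [NormedAddCommGroup EM] [NormedSpace ℝ EM]
    [FiniteDimensional ℝ EM]
    {M : Type*} [TopologicalSpace M] [ChartedSpace EM M]
    (X₀ : Set M) (hX₀ : IsCompact X₀)
    (φ : M → M) (hφ : ContMDiff 𝓘(ℝ, EM) 𝓘(ℝ, EM) 1 φ)
    (ψ : ℝ → M → M)
    (hψ : ContMDiffOn (𝓘(ℝ, ℝ).prod 𝓘(ℝ, EM)) 𝓘(ℝ, EM) 1
      (fun p : ℝ × M => ψ p.1 p.2) (Icc (0:ℝ) 1 ×ˢ univ))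
    (hψ0 : ψ 0 = id)
    (f : M → ℝ) (hf : ContMDiff 𝓘(ℝ, EM) 𝓘(ℝ) 1 f)
    (hfX₀ : ∀ x ∈ X₀, f x ≤ 0) (hfφ : ∀ x ∈ X₀, 0 ≤ f (φ x))
    (hd1 : ∀ x ∈ X₀, derivWithin (fun t => f (ψ t x)) (Ici (0:ℝ)) 0 ≤ 0)
    (hd2 : ∀ x ∈ X₀, 0 < derivWithin (fun t => f (φ (ψ t x))) (Ici (0:ℝ)) 0) :
    ∃ t₀ > (0:ℝ), ∀ t ∈ Ioc (0:ℝ) t₀, (φ ∘ ψ t) '' X₀ ∩ ψ t '' X₀ = ∅ := by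
  have hg := hf.comp_contMDiffOn hψ
  have hh := (hf.comp hφ).comp_contMDiffOn hψ
  have key : ∀ z ∈ X₀ ×ˢ X₀, ∀ᶠ q : ℝ × (M × M) in 𝓝 (0, z),
      q.2 ∈ X₀ ×ˢ X₀ → 0 < q.1 → f (ψ q.1 q.2.2) < f (φ (ψ q.1 q.2.1)) := by
    rintro ⟨x, y⟩ ⟨hx, hy⟩
    set a := derivWithin (fun t => f (φ (ψ t x))) (Ici (0:ℝ)) 0
    have ha0 : 0 < a := hd2 x hx
    have h1 := (hg (0, y) (by simp)).eventually_le_add_mul (c := a / 3)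
      ((hd1 y hy).trans_lt (by positivity))
    have h2 := (contMDiff_neg (I := 𝓘(ℝ)) (n := 1)).contMDiffAt.comp_contMDiffWithinAt _
      (hh (0, x) (by simp))
    have h3 := h2.eventually_le_add_mul (c := -(a / 2)) (by
      have : derivWithin (fun t => -f (φ (ψ t x))) (Ici (0:ℝ)) 0 = -a := derivWithin.fun_neg
      exact this.trans_lt (by linarith))
    have c1 : Tendsto (fun q : ℝ × (M × M) => (q.1, q.2.2)) (𝓝 (0, (x, y))) (𝓝 (0, y)) :=
      Continuous.tendsto (by fun_prop) (0, (x, y))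
    have c2 : Tendsto (fun q : ℝ × (M × M) => (q.1, q.2.1)) (𝓝 (0, (x, y))) (𝓝 (0, x)) :=
      Continuous.tendsto (by fun_prop) (0, (x, y))
    filter_upwards [c1.eventually h1, c2.eventually h3] with q hq1 hq2 hq hq0
    have e1 := hq1 hq0.le
    have e2 := hq2 hq0.le
    simp only [Function.comp_apply, hψ0, id] at e1 e2
    have := hfX₀ _ hq.2
    have := hfφ _ hq.1
    nlinarith [mul_pos ha0 hq0]
  have hev := (hX₀.prod hX₀).eventually_forall_of_forall_eventually (x₀ := (0:ℝ))
    (P := fun t z => z ∈ X₀ ×ˢ X₀ → 0 < t → f (ψ t z.2) < f (φ (ψ t z.1))) key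
  obtain ⟨δ, hδ, hball⟩ := Metric.eventually_nhds_iff.1 hev
  refine ⟨δ / 2, by positivity, fun t ht => ?_⟩
  rw [← disjoint_iff_inter_eq_empty, Set.disjoint_left]
  rintro _ ⟨x, hx, rfl⟩ ⟨y, hy, hxy⟩
  have hlt := hball (y := t) (by rw [Real.dist_eq, sub_zero, abs_of_pos ht.1]; linarith [ht.2])
    (x, y) ⟨hx, hy⟩ ⟨hx, hy⟩ ht.1
  simp [hxy] at hlt
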